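/- Suppose all existentially closed models of T₀ have the same existential theory, and let α, β be e-atomic expansions of N. Then every finite 1-elementary partial map f : (N,α) → (N,β) (i.e. one preserving all existential and all universal formulas) extends to an isomorphism (N,α) → (N,β). -/

import Mathlib

open FirstOrder FirstOrder.Language

namespace GenExp

/-- The type of expansions of the `L`-structure `N` to the language `L.sum L'`:
an expansion is an interpretation of the new symbols, i.e. an `L'`-structure on `N`. -/
def Expansions (L L' : FirstOrder.Language.{0,0}) (N : Type) [L.Structure N] : Type :=
  L'.Structure N

variable {L L' : FirstOrder.Language.{0,0}} {N : Type} [L.Structure N]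

/-- The underlying `L'`-structure of an expansion. -/
def Expansions.str (σ : Expansions L L' N) : L'.Structure N := σ

/-- The `(L.sum L')`-structure on `N` determined by an expansion. -/
def Expansions.str0 (σ : Expansions L L' N) : (L.sum L').Structure N :=
  letI := σ.str
  inferInstance

/-- `(N, σ)` realizes the `L₀`-formula `φ` at the tuple `c` of parameters. -/
def Expansions.Realizes (σ : Expansions L L' N) {n : ℕ}
    (φ : (L.sum L').Formula (Fin n)) (c : Fin n → N) : Prop :=
  letI := σ.str0
  φ.Realize c

/-- `(N, σ)` is a model of the `L₀`-theory `T₀`. -/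
def Expansions.ModelsTh (σ : Expansions L L' N) (T₀ : (L.sum L').Theory) : Prop :=
  letI := σ.str0
  N ⊨ T₀

/-- The topology on `Exp(N)` generated by the sets `[φ]_N` for quantifier-free
`L₀`-sentences `φ` with parameters in `N` (coded as formulas plus an assignment). -/
instance (L L' : FirstOrder.Language.{0,0}) (N : Type) [L.Structure N] :
    TopologicalSpace (Expansions L L' N) :=
  TopologicalSpace.generateFrom
    {s | ∃ (n : ℕ) (φ : (L.sum L').Formula (Fin n)) (c : Fin n → N),
      φ.IsQF ∧ s = {σ : Expansions L L' N | σ.Realizes φ c}}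

/-- `Exp(N, T₀)`, as a subset of `Exp(N)`. -/
def ExpSet (L L' : FirstOrder.Language.{0,0}) (N : Type) [L.Structure N] (T₀ : (L.sum L').Theory) :
    Set (Expansions L L' N) :=
  {σ | σ.ModelsTh T₀}

/-- An `L₀`-sentence is universal modulo `T` if it is equivalent to a universal sentence
in every model of `T`. -/
def UniversalModulo (L L' : FirstOrder.Language.{0,0}) (T : L.Theory) (φ : (L.sum L').Sentence) : Prop :=
  ∃ ψ : (L.sum L').Sentence, BoundedFormula.IsUniversal ψ ∧
    ∀ (U : Type) [L.Structure U] [L'.Structure U], U ⊨ T → (U ⊨ φ ↔ U ⊨ ψ)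

/-- A theory is universal modulo `T` if all its sentences are. -/
def UniversalTheoryModulo (L L' : FirstOrder.Language.{0,0}) (T : L.Theory)
    (T₀ : (L.sum L').Theory) : Prop :=
  ∀ φ ∈ T₀, UniversalModulo L L' T φ

/-- `T` has quantifier elimination. -/
def HasQE (L : FirstOrder.Language.{0,0}) (T : L.Theory) : Prop :=
  ∀ (n : ℕ) (φ : L.Formula (Fin n)), ∃ ψ : L.Formula (Fin n), ψ.IsQF ∧ T ⊨ᵇ φ.iff ψ

/-- `T` is small: countably many complete `n`-types for every `n`. -/
def IsSmall (L : FirstOrder.Language.{0,0}) (T : L.Theory) : Prop :=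
  ∀ n : ℕ, Countable (T.CompleteType (Fin n))

/-- `N` is (ω-)saturated: every finitely realized set of `L`-formulas in one variable
with finitely many parameters in `N` is realized in `N`. -/
def IsSaturated (L : FirstOrder.Language.{0,0}) (N : Type) [L.Structure N] : Prop :=
  ∀ (k : ℕ) (c : Fin k → N) (p : Set (L.Formula (Fin k ⊕ Fin 1))),
    (∀ s : Finset (L.Formula (Fin k ⊕ Fin 1)), ↑s ⊆ p →
      ∃ x : N, ∀ φ ∈ s, φ.Realize (Sum.elim c fun _ => x)) →
    ∃ x : N, ∀ φ ∈ p, φ.Realize (Sum.elim c fun _ => x)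

/-- `σ` is an existentially closed expansion: every quantifier-free `L₀`-formula with
parameters in `N` that has a solution in some model of `T₀` extending `(N, σ)` has a
solution in `(N, σ)`. -/
def Expansions.IsEC (σ : Expansions L L' N) (T₀ : (L.sum L').Theory) : Prop :=
  letI := σ.str0
  ∀ (k n : ℕ) (φ : (L.sum L').Formula (Fin k ⊕ Fin n)) (c : Fin k → N), φ.IsQF →
    (∃ (U : Type) (iU : L.Structure U) (iU' : L'.Structure U),
      letI := iU; letI := iU';
      ∃ _j : N ↪[L.sum L'] U, (U ⊨ T₀) ∧ ∃ x : Fin n → U, φ.Realize (Sum.elim (_j ∘ c) x)) →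
    ∃ x : Fin n → N, φ.Realize (Sum.elim c x)

/-- `σ` is a smooth expansion: it realizes every finitely consistent type of the form
`p↾L(x) ∪ {ψ(x)}` with `ψ` quantifier-free in `L₀` and `p↾L` an `L`-type with finitely
many parameters. -/
def Expansions.IsSmooth (σ : Expansions L L' N) : Prop :=
  letI := σ.str0
  ∀ (k n : ℕ) (c : Fin k → N) (p : Set (L.Formula (Fin k ⊕ Fin n)))
    (ψ : (L.sum L').Formula (Fin k ⊕ Fin n)), ψ.IsQF →
    (∀ s : Finset (L.Formula (Fin k ⊕ Fin n)), ↑s ⊆ p →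
      ∃ x : Fin n → N, ψ.Realize (Sum.elim c x) ∧
        ∀ χ ∈ s, Formula.Realize (L := L) (M := N) χ (Sum.elim c x)) →
    ∃ x : Fin n → N, ψ.Realize (Sum.elim c x) ∧
      ∀ χ ∈ p, Formula.Realize (L := L) (M := N) χ (Sum.elim c x)

/-- The set `Y` of smooth existentially closed expansions in `Exp(N, T₀)`. -/
def YSet (L L' : FirstOrder.Language.{0,0}) (N : Type) [L.Structure N] (T₀ : (L.sum L').Theory) :
    Set (Expansions L L' N) :=
  {σ | σ.ModelsTh T₀ ∧ σ.IsSmooth ∧ σ.IsEC T₀}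


/-- A general existentially closed model of `T₀` (in the class of models of `T₀`). -/
def IsECModel (L L' : FirstOrder.Language.{0,0}) (T₀ : (L.sum L').Theory)
    (U : Type) [L.Structure U] [L'.Structure U] : Prop :=
  (U ⊨ T₀) ∧
  ∀ (k n : ℕ) (φ : (L.sum L').Formula (Fin k ⊕ Fin n)) (c : Fin k → U), φ.IsQF →
    (∃ (V : Type) (iV : L.Structure V) (iV' : L'.Structure V),
      letI := iV; letI := iV';
      ∃ _j : U ↪[L.sum L'] V, (V ⊨ T₀) ∧ ∃ x : Fin n → V, φ.Realize (Sum.elim (_j ∘ c) x)) →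
    ∃ x : Fin n → U, φ.Realize (Sum.elim c x)

/-- All existentially closed models of `T₀` have the same existential theory. -/
def SameExistentialTheory (L L' : FirstOrder.Language.{0,0}) (T₀ : (L.sum L').Theory) : Prop :=
  ∀ (U : Type) [L.Structure U] [L'.Structure U] (V : Type) [L.Structure V] [L'.Structure V],
    IsECModel L L' T₀ U → IsECModel L L' T₀ V →
    ∀ φ : (L.sum L').Sentence, BoundedFormula.IsExistential φ → ((U ⊨ φ) ↔ (V ⊨ φ))

/-- An existential quasifinite formula `∃ y (p(x,y) ∧ φ(x,y))`, where `p` is a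
parameter-free `L`-type and `φ` is a quantifier-free `L₀`-formula. -/
structure EQF (L L' : FirstOrder.Language.{0,0}) (n : ℕ) : Type where
  m : ℕ
  p : Set (L.Formula (Fin n ⊕ Fin m))
  φ : (L.sum L').Formula (Fin n ⊕ Fin m)
  qf : φ.IsQF

/-- Realization of an existential quasifinite formula at a tuple `b` in `(N, σ)`. -/
def EQF.RealizeAt {n : ℕ} (π : EQF L L' n) (σ : Expansions L L' N) (b : Fin n → N) : Prop :=
  letI := σ.str0
  ∃ y : Fin π.m → N,
    (∀ χ ∈ π.p, Formula.Realize (L := L) (M := N) χ (Sum.elim b y)) ∧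
      π.φ.Realize (Sum.elim b y)

/-- The complete parameter-free `L₀`-type of the tuple `a` in `(N, σ)`. -/
def fullType (σ : Expansions L L' N) {n : ℕ} (a : Fin n → N) :
    Set ((L.sum L').Formula (Fin n)) :=
  {φ | σ.Realizes φ a}

/-- `p↾1`: the universal and existential formulas in `p`. -/
def restr1 {L L' : FirstOrder.Language.{0,0}} {n : ℕ}
    (p : Set ((L.sum L').Formula (Fin n))) : Set ((L.sum L').Formula (Fin n)) :=
  {φ ∈ p | BoundedFormula.IsUniversal φ ∨ BoundedFormula.IsExistential φ}

/-- The 1-diagram of `σ` at `b`: all universal and existential formulas satisfied by `b`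
in `(N, σ)` (coding sentences with parameters `b` as formulas). -/
def diag1 (σ : Expansions L L' N) {n : ℕ} (b : Fin n → N) :
    Set ((L.sum L').Formula (Fin n)) :=
  restr1 (fullType σ b)

variable (L L' N) in
/-- The set `D_b` of 1-diagrams at `b` of expansions in `Y`. -/
def DSet (T₀ : (L.sum L').Theory) {n : ℕ} (b : Fin n → N) :
    Set (Set ((L.sum L').Formula (Fin n))) :=
  {d | ∃ σ ∈ YSet L L' N T₀, d = diag1 σ b}

variable (L L' N) in
/-- The basic subset `[π(b)]_D` of `D_b`. -/
def DBasic (T₀ : (L.sum L').Theory) {n : ℕ} (b : Fin n → N) (π : EQF L L' n) :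
    Set (Set ((L.sum L').Formula (Fin n))) :=
  {d | ∃ σ ∈ YSet L L' N T₀, d = diag1 σ b ∧ π.RealizeAt σ b}

variable (L L' N) in
/-- The topology on `D_b` generated by the sets `[π(b)]_D`. -/
def DTop (T₀ : (L.sum L').Theory) {n : ℕ} (b : Fin n → N) :
    TopologicalSpace ↥(DSet L L' N T₀ b) :=
  TopologicalSpace.generateFrom
    {s | ∃ π : EQF L L' n, s = {d | ↑d ∈ DBasic L L' N T₀ b π}}

variable (L L' N) in
/-- The set `S_x^Y` of types `p↾1` for `p` a complete parameter-free type realized in `Y`. -/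
def SSet (T₀ : (L.sum L').Theory) (n : ℕ) : Set (Set ((L.sum L').Formula (Fin n))) :=
  {q | ∃ σ ∈ YSet L L' N T₀, ∃ a : Fin n → N, q = diag1 σ a}

variable (L L' N) in
/-- The basic subset `[π(x)]_S` of `S_x^Y`. -/
def SBasic (T₀ : (L.sum L').Theory) {n : ℕ} (π : EQF L L' n) :
    Set (Set ((L.sum L').Formula (Fin n))) :=
  {q | ∃ σ ∈ YSet L L' N T₀, ∃ a : Fin n → N, q = diag1 σ a ∧ π.RealizeAt σ a}

variable (L L' N) in
/-- The topology on `S_x^Y` generated by the sets `[π(x)]_S`. -/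
def STop (T₀ : (L.sum L').Theory) (n : ℕ) : TopologicalSpace ↥(SSet L L' N T₀ n) :=
  TopologicalSpace.generateFrom
    {s | ∃ π : EQF L L' n, s = {q | ↑q ∈ SBasic L L' N T₀ π}}

variable (L L' N) in
/-- `α` is an e-atomic expansion: it is in `Y` and each of its 1-diagrams is an
isolated point of `D_b`. -/
def IsEAtomic (T₀ : (L.sum L').Theory) (α : Expansions L L' N) : Prop :=
  α ∈ YSet L L' N T₀ ∧ ∀ (n : ℕ) (b : Fin n → N),
    @IsOpen _ (DTop L L' N T₀ b) {d | (d : Set ((L.sum L').Formula (Fin n))) = diag1 α b}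

/-- The conjugate expansion `σ^g` of `σ` under an automorphism `g` of `N`. -/
def conjExp (g : N ≃[L] N) (σ : Expansions L L' N) : Expansions L L' N :=
  show L'.Structure N from
  { funMap := fun {_} F a => g ((σ.str).funMap F fun i => g.symm (a i))
    RelMap := fun {_} R a => (σ.str).RelMap R fun i => g.symm (a i) }

variable (L L' N) in
/-- `τ` is Truss generic: its conjugacy class is comeagre in `Exp(N, T₀)`. -/
def IsTrussGeneric (T₀ : (L.sum L').Theory) (τ : Expansions L L' N) : Prop :=
  τ.ModelsTh T₀ ∧
    {σ : ↥(ExpSet L L' N T₀) | ∃ g : N ≃[L] N, (σ : Expansions L L' N) = conjExp g τ} ∈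
      residual ↥(ExpSet L L' N T₀)


variable (L L' N) in
/-- The quantifier-free formula `φ` (with parameters `c`) has a solution in `(N, σ)`. -/
def SolvableIn (σ : Expansions L L' N) {k n : ℕ}
    (φ : (L.sum L').Formula (Fin k ⊕ Fin n)) (c : Fin k → N) : Prop :=
  letI := σ.str0
  ∃ x : Fin n → N, φ.Realize (Sum.elim c x)

variable (L L' N) in
/-- The formula `φ` (with parameters `c`) has a solution in some model of `T₀`
extending `(N, σ)`. -/
def SolvableInExtension (T₀ : (L.sum L').Theory) (σ : Expansions L L' N) {k n : ℕ}
    (φ : (L.sum L').Formula (Fin k ⊕ Fin n)) (c : Fin k → N) : Prop :=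
  letI := σ.str0
  ∃ (U : Type) (iU : L.Structure U) (iU' : L'.Structure U),
    letI := iU; letI := iU';
    ∃ _j : N ↪[L.sum L'] U, (U ⊨ T₀) ∧ ∃ x : Fin n → U, φ.Realize (Sum.elim (_j ∘ c) x)

section Formulas
variable {L L' : FirstOrder.Language.{0,0}} {ι : Type}

theorem isExistential_exs : ∀ {n : ℕ} {φ : L.BoundedFormula ι n},
    φ.IsExistential → BoundedFormula.IsExistential φ.exs
  | 0, _, h => h
  | _ + 1, φ, h => isExistential_exs (φ := φ.ex) h.ex

theorem isUniversal_alls : ∀ {n : ℕ} {φ : L.BoundedFormula ι n},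
    φ.IsUniversal → BoundedFormula.IsUniversal φ.alls
  | 0, _, h => h
  | _ + 1, φ, h => isUniversal_alls (φ := φ.all) h.all

theorem isExistential_iExs {γ : Type} [Finite γ] {φ : L.Formula (ι ⊕ γ)} (h : φ.IsQF) :
    BoundedFormula.IsExistential (φ.iExs γ) :=
  isExistential_exs (h.relabel _).isExistential

theorem isUniversal_iAlls {γ : Type} [Finite γ] {φ : L.Formula (ι ⊕ γ)} (h : φ.IsQF) :
    BoundedFormula.IsUniversal (φ.iAlls γ) :=
  isUniversal_alls (h.relabel _).isUniversal

theorem isQF_onBoundedFormula (f : L →ᴸ L') {n : ℕ} {φ : L.BoundedFormula ι n} (h : φ.IsQF) :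
    (f.onBoundedFormula φ).IsQF := by
  induction h with
  | falsum => exact .falsum
  | of_isAtomic h =>
    cases h with
    | equal => exact .of_isAtomic (.equal _ _)
    | rel => exact .of_isAtomic (.rel _ _)
  | imp _ _ h₁ h₂ => exact h₁.imp h₂

theorem isQF_finset_inf {κ : Type} (s : Finset κ) {f : κ → L.Formula ι} (h : ∀ i, (f i).IsQF) :
    ∃ φ : L.Formula ι, φ.IsQF ∧ ∀ (M : Type) [L.Structure M] (v : ι → M),
      φ.Realize v ↔ ∀ i ∈ s, (f i).Realize v := by
  classical
  induction s using Finset.induction_on with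
  | empty => exact ⟨⊤, .top, by simp⟩
  | insert i s _ ih =>
    obtain ⟨φ, hφ, hr⟩ := ih
    exact ⟨f i ⊓ φ, (h i).inf hφ, by simp [hr]⟩

end Formulas

section Equiv

variable {L : FirstOrder.Language.{0,0}} {M M₁ : Type} [L.Structure M] [L.Structure M₁]

/-- A bijection preserving quantifier-free formulas is an isomorphism. -/
def equivOfRealize (e : M ≃ M₁) (h : ∀ (n : ℕ) (φ : L.Formula (Fin n)), φ.IsQF →
    ∀ c : Fin n → M, φ.Realize c ↔ φ.Realize (e ∘ c)) : M ≃[L] M₁ where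
  toEquiv := e
  map_fun' {n} F x := by
    have key := h (n + 1) (Formula.graph F) (Formula.isAtomic_graph F).isQF
      (Fin.cons (Structure.funMap F x) x)
    have hc : e ∘ (Fin.cons (Structure.funMap F x) x : Fin (n + 1) → M) =
        (Fin.cons (e (Structure.funMap F x)) (e ∘ x) : Fin (n + 1) → M₁) :=
      Fin.comp_cons e _ _
    rw [hc, Formula.realize_graph, Formula.realize_graph] at key
    exact (key.1 rfl).symm
  map_rel' {n} R x := by
    have key := h n (R.formula fun i => Term.var i) (R.isQF _) x
    rw [Formula.realize_rel, Formula.realize_rel] at key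
    exact key.symm

theorem realize_comp_equiv (g : M ≃[L] M₁) {ι : Type} (φ : L.Formula ι) (v : ι → M) :
    φ.Realize (g ∘ v) ↔ φ.Realize v :=
  StrongHomClass.realize_formula g φ

theorem models_of_equiv (g : M ≃[L] M₁) {T : L.Theory} (h : M ⊨ T) : M₁ ⊨ T :=
  StrongHomClass.theory_model g

end Equiv

section BackAndForth

/-- The tuple `a` followed by the entry `c`. -/
def extend {M : Type} {k : ℕ} (a : Fin k → M) (c : M) : Fin (k + 1) → M :=
  Sum.elim a (fun _ : Fin 1 => c) ∘ finSumFinEquiv.symm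

theorem extend_comp {M : Type} {k : ℕ} (a : Fin k → M) (c : M) :
    extend a c ∘ finSumFinEquiv = Sum.elim a fun _ : Fin 1 => c := by
  ext x; simp [extend]

theorem extend_left {M : Type} {k : ℕ} (a : Fin k → M) (c : M) (i : Fin k) :
    extend a c (finSumFinEquiv (Sum.inl i)) = a i :=
  congr_fun (extend_comp a c) (Sum.inl i)

theorem extend_right {M : Type} {k : ℕ} (a : Fin k → M) (c : M) :
    extend a c (finSumFinEquiv (Sum.inr (0 : Fin 1))) = c :=
  congr_fun (extend_comp a c) (Sum.inr 0)

variable {M M₁ : Type}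
  (P : ∀ k : ℕ, (Fin k → M) → (Fin k → M₁) → Prop)

/-- The pairs of tuples of equal length satisfying `P`. -/
def PartialMap : Type :=
  {x : Σ k : ℕ, (Fin k → M) × (Fin k → M₁) // P x.1 x.2.1 x.2.2}

variable {P}

/-- Both tuples of `y` restrict to those of `x` along a common reindexing. -/
instance : Preorder (PartialMap P) where
  le x y := ∃ s : Fin x.1.1 → Fin y.1.1, x.1.2.1 = y.1.2.1 ∘ s ∧ x.1.2.2 = y.1.2.2 ∘ s
  le_refl _ := ⟨id, rfl, rfl⟩
  le_trans := by
    rintro x y z ⟨s, hs, hs'⟩ ⟨t, ht, ht'⟩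
    exact ⟨t ∘ s, by rw [hs, ht]; rfl, by rw [hs', ht']; rfl⟩

theorem exists_equiv_of_backAndForth [Countable M] [Countable M₁]
    (reindex : ∀ {k m : ℕ} (s : Fin m → Fin k) (a : Fin k → M) (b : Fin k → M₁),
      P k a b → P m (a ∘ s) (b ∘ s))
    (inj : ∀ {k : ℕ} {a : Fin k → M} {b : Fin k → M₁}, P k a b → ∀ i j, a i = a j ↔ b i = b j)
    (forth : ∀ {k : ℕ} {a : Fin k → M} {b : Fin k → M₁}, P k a b →
      ∀ c, ∃ d, P (k + 1) (extend a c) (extend b d))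
    (back : ∀ {k : ℕ} {a : Fin k → M} {b : Fin k → M₁}, P k a b →
      ∀ d, ∃ c, P (k + 1) (extend a c) (extend b d))
    {k : ℕ} {a : Fin k → M} {b : Fin k → M₁} (hab : P k a b) :
    ∃ e : M ≃ M₁, e ∘ a = b ∧ ∀ (n : ℕ) (c : Fin n → M), P n c (e ∘ c) := by
  have := Encodable.ofCountable M
  have := Encodable.ofCountable M₁
  let D : M ⊕ M₁ → Order.Cofinal (PartialMap P) := Sum.elim
    (fun c => ⟨{x | ∃ i, x.1.2.1 i = c}, fun x => by
      obtain ⟨d, hd⟩ := forth x.2 c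
      exact ⟨⟨⟨_, _, _⟩, hd⟩, ⟨_, extend_right _ _⟩, ⟨fun i => finSumFinEquiv (Sum.inl i),
        funext fun i => (extend_left _ _ i).symm, funext fun i => (extend_left _ _ i).symm⟩⟩⟩)
    (fun d => ⟨{x | ∃ i, x.1.2.2 i = d}, fun x => by
      obtain ⟨c, hc⟩ := back x.2 d
      exact ⟨⟨⟨_, _, _⟩, hc⟩, ⟨_, extend_right _ _⟩, ⟨fun i => finSumFinEquiv (Sum.inl i),
        funext fun i => (extend_left _ _ i).symm, funext fun i => (extend_left _ _ i).symm⟩⟩⟩)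
  let p : PartialMap P := ⟨⟨k, a, b⟩, hab⟩
  let I := Order.idealOfCofinals p D
  let r (c : M) (d : M₁) : Prop := ∃ x ∈ I, ∃ i, x.1.2.1 i = c ∧ x.1.2.2 i = d
  have total (c : M) : ∃ d, r c d := by
    obtain ⟨x, ⟨i, hi⟩, hx⟩ := Order.cofinal_meets_idealOfCofinals p D (Sum.inl c)
    exact ⟨_, x, hx, i, hi, rfl⟩
  have total' (d : M₁) : ∃ c, r c d := by
    obtain ⟨x, ⟨i, hi⟩, hx⟩ := Order.cofinal_meets_idealOfCofinals p D (Sum.inr d)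
    exact ⟨_, x, hx, i, rfl, hi⟩
  have common (n : ℕ) (c : Fin n → M) (d : Fin n → M₁) (h : ∀ j, r (c j) (d j)) :
      P n c d := by
    choose x hx i hc hd using h
    have hdir : Directed (· ≤ ·) ((↑) : I → PartialMap P) := I.directed.directed_val
    have : Nonempty I := ⟨⟨p, Order.mem_idealOfCofinals p D⟩⟩
    obtain ⟨z, hz⟩ := hdir.finite_le (fun j => (⟨x j, hx j⟩ : I))
    choose s hs hs' using hz
    have := reindex (fun j => s j (i j)) _ _ z.1.2
    convert this using 1
    · ext j; rw [← hc j, hs j]; rfl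
    · ext j; rw [← hd j, hs' j]; rfl
  have uniq {c c' d d'} (h : r c d) (h' : r c' d') : c = c' ↔ d = d' := by
    have := common 2 ![c, c'] ![d, d'] (by intro j; fin_cases j <;> assumption)
    simpa using inj this 0 1
  choose f hf using total
  choose g hg using total'
  refine ⟨⟨f, g, fun c => (uniq (hg _) (hf _)).2 rfl, fun d => (uniq (hf _) (hg _)).1 rfl⟩,
    funext fun i => ?_, fun n c => common n _ _ fun j => hf _⟩
  exact (uniq (hf (a i)) ⟨p, Order.mem_idealOfCofinals p D, i, rfl, rfl⟩).1 rfl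

end BackAndForth

section SameType

variable {L : FirstOrder.Language.{0,0}} {N : Type} [L.Structure N]

variable (L) in
/-- Two tuples with the same complete parameter-free type. -/
def SameType {ι : Type} (u v : ι → N) : Prop :=
  ∀ χ : L.Formula ι, χ.Realize u ↔ χ.Realize v

theorem SameType.symm {ι : Type} {u v : ι → N} (h : SameType L u v) : SameType L v u :=
  fun χ => (h χ).symm

theorem SameType.trans {ι : Type} {u v w : ι → N} (h : SameType L u v) (h' : SameType L v w) :
    SameType L u w :=
  fun χ => (h χ).trans (h' χ)

theorem SameType.comp {ι κ : Type} {u v : ι → N} (h : SameType L u v) (s : κ → ι) :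
    SameType L (u ∘ s) (v ∘ s) := fun χ => by
  simpa only [Formula.realize_relabel] using h (χ.relabel s)

theorem sameType_of_imp {ι : Type} {u v : ι → N}
    (h : ∀ χ : L.Formula ι, χ.Realize u → χ.Realize v) : SameType L u v := fun χ =>
  ⟨h χ, fun hv => by_contra fun hu => Formula.realize_not.1 (h χ.not (Formula.realize_not.2 hu)) hv⟩

theorem sameType_equiv {ι : Type} (g : N ≃[L] N) (u : ι → N) : SameType L u (g ∘ u) :=
  fun χ => (StrongHomClass.realize_formula g χ).symm

theorem SameType.eq_iff {ι : Type} {u v : ι → N} (h : SameType L u v) (i j : ι) :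
    u i = u j ↔ v i = v j := by
  simpa [Formula.realize_equal] using h (Term.equal (Term.var i) (Term.var j))

theorem SameType.exists_extend (hsat : IsSaturated L N) {k : ℕ} {a b : Fin k → N}
    (h : SameType L a b) (c : N) : ∃ d, SameType L (extend a c) (extend b d) := by
  obtain ⟨d, hd⟩ := hsat k b {χ | χ.Realize (Sum.elim a fun _ => c)} fun s hs => by
    let Φ : L.Formula (Fin k ⊕ Fin 1) := Formula.iInf fun χ : s => χ.1
    obtain ⟨x, hx⟩ := Formula.realize_iExs.1 ((h (Φ.iExs (Fin 1))).1
      (Formula.realize_iExs.2 ⟨fun _ => c, Formula.realize_iInf.2 fun χ => hs χ.2⟩))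
    refine ⟨x 0, fun χ hχ => ?_⟩
    have := Formula.realize_iInf.1 hx ⟨χ, hχ⟩
    rwa [show x = fun _ => x 0 from funext fun i => congrArg x (Subsingleton.elim i 0)] at this
  exact ⟨d, (sameType_of_imp hd).comp finSumFinEquiv.symm⟩

theorem SameType.exists_automorphism [Countable N] (hsat : IsSaturated L N) {k : ℕ}
    {a b : Fin k → N} (h : SameType L a b) : ∃ g : N ≃[L] N, g ∘ a = b := by
  obtain ⟨e, he, hP⟩ := exists_equiv_of_backAndForth
    (P := fun k (a b : Fin k → N) => SameType L a b)
    (fun s _ _ h => h.comp s) (fun h => h.eq_iff) (fun h => h.exists_extend hsat)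
    (fun h d => (h.symm.exists_extend hsat d).imp fun _ => SameType.symm) h
  exact ⟨equivOfRealize e fun n φ _ c => hP n c φ, he⟩

end SameType
section Expansions

variable {L L' : FirstOrder.Language.{0,0}} {N : Type} [L.Structure N]
  {σ τ ρ : Expansions L L' N} {ι κ : Type}

/-- `(N, σ)` realizes `φ` at the assignment `v`. -/
def Expansions.Sat (σ : Expansions L L' N) (φ : (L.sum L').Formula ι) (v : ι → N) : Prop :=
  letI := σ.str0
  φ.Realize v

theorem sat_relabel {φ : (L.sum L').Formula ι} {s : ι → κ} {v : κ → N} :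
    σ.Sat (φ.relabel s) v ↔ σ.Sat φ (v ∘ s) :=
  letI := σ.str0
  Formula.realize_relabel

theorem sat_inf {φ ψ : (L.sum L').Formula ι} {v : ι → N} :
    σ.Sat (φ ⊓ ψ) v ↔ σ.Sat φ v ∧ σ.Sat ψ v :=
  letI := σ.str0
  Formula.realize_inf

theorem sat_not {φ : (L.sum L').Formula ι} {v : ι → N} :
    σ.Sat φ.not v ↔ ¬ σ.Sat φ v :=
  letI := σ.str0
  Formula.realize_not

theorem sat_iExs [Finite κ] {φ : (L.sum L').Formula (ι ⊕ κ)} {v : ι → N} :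
    σ.Sat (φ.iExs κ) v ↔ ∃ y, σ.Sat φ (Sum.elim v y) :=
  letI := σ.str0
  Formula.realize_iExs

theorem sat_iAlls [Finite κ] {φ : (L.sum L').Formula (ι ⊕ κ)} {v : ι → N} :
    σ.Sat (φ.iAlls κ) v ↔ ∀ y, σ.Sat φ (Sum.elim v y) :=
  letI := σ.str0
  Formula.realize_iAlls

theorem sat_onFormula {φ : L.Formula ι} {v : ι → N} :
    σ.Sat ((LHom.sumInl : L →ᴸ L.sum L').onFormula φ) v ↔ φ.Realize v :=
  letI := σ.str0
  haveI : (LHom.sumInl : L →ᴸ L.sum L').IsExpansionOn N := ⟨fun _ _ => rfl, fun _ _ => rfl⟩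
  LHom.realize_onFormula _ _

/-- The tuples `a` in `(N, σ)` and `b` in `(N, τ)` satisfy the same existential formulas. -/
def EEquiv (σ τ : Expansions L L' N) {k : ℕ} (a b : Fin k → N) : Prop :=
  ∀ (m : ℕ) (φ : (L.sum L').Formula (Fin k ⊕ Fin m)), φ.IsQF →
    ((∃ y, σ.Sat φ (Sum.elim a y)) ↔ ∃ y, τ.Sat φ (Sum.elim b y))

variable {k : ℕ} {a b c : Fin k → N}

theorem EEquiv.symm (h : EEquiv σ τ a b) : EEquiv τ σ b a :=
  fun m φ hφ => (h m φ hφ).symm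

theorem EEquiv.trans (h : EEquiv σ τ a b) (h' : EEquiv τ ρ b c) : EEquiv σ ρ a c :=
  fun m φ hφ => (h m φ hφ).trans (h' m φ hφ)

theorem EEquiv.exists_iff [Finite ι] (h : EEquiv σ τ a b) {φ : (L.sum L').Formula (Fin k ⊕ ι)}
    (hφ : φ.IsQF) : (∃ y, σ.Sat φ (Sum.elim a y)) ↔ ∃ y, τ.Sat φ (Sum.elim b y) := by
  let e := Finite.equivFin ι
  have key (ρ : Expansions L L' N) (u : Fin k → N) :
      (∃ y, ρ.Sat (φ.relabel (Sum.map id e)) (Sum.elim u y)) ↔ ∃ y, ρ.Sat φ (Sum.elim u y) := by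
    simp only [sat_relabel, Sum.elim_comp_map, Function.comp_id]
    exact ⟨fun ⟨y, hy⟩ => ⟨_, hy⟩, fun ⟨y, hy⟩ => ⟨y ∘ e.symm, by
      simpa [Function.comp_assoc] using hy⟩⟩
  rw [← key σ, ← key τ]
  exact h _ _ (hφ.relabel _)

theorem EEquiv.sat_iff (h : EEquiv σ τ a b) {φ : (L.sum L').Formula (Fin k)} (hφ : φ.IsQF) :
    σ.Sat φ a ↔ τ.Sat φ b := by
  simpa [sat_relabel] using
    h 0 (φ.relabel (Sum.inl : Fin k → Fin k ⊕ Fin 0)) (hφ.relabel _)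

theorem EEquiv.comp (h : EEquiv σ τ a b) {m : ℕ} (s : Fin m → Fin k) :
    EEquiv σ τ (a ∘ s) (b ∘ s) := fun n φ hφ => by
  simpa [sat_relabel, Sum.elim_comp_map] using h n (φ.relabel (Sum.map s id)) (hφ.relabel _)

theorem EEquiv.eq_iff (h : EEquiv σ τ a b) (i j : Fin k) : a i = a j ↔ b i = b j := by
  have := h.sat_iff (φ := (LHom.sumInl : L →ᴸ L.sum L').onFormula
    (Term.equal (Term.var i) (Term.var j)))
    (isQF_onBoundedFormula _ (BoundedFormula.IsAtomic.equal _ _).isQF)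
  simpa [sat_onFormula, Formula.realize_equal] using this

theorem eEquiv_of_imp (h : ∀ φ : (L.sum L').Formula (Fin k),
    BoundedFormula.IsUniversal φ ∨ BoundedFormula.IsExistential φ →
      σ.Realizes φ a → τ.Realizes φ b) : EEquiv σ τ a b := fun m φ hφ => by
  refine ⟨fun hy => sat_iExs.1 (h _ (.inr (isExistential_iExs hφ)) (sat_iExs.2 hy)), fun hy => ?_⟩
  by_contra hn
  push Not at hn
  obtain ⟨y, hy⟩ := hy
  exact sat_not.1 (sat_iAlls.1 (h (φ.not.iAlls (Fin m)) (.inl (isUniversal_iAlls hφ.not))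
    (sat_iAlls.2 fun z => sat_not.2 (hn z))) y) hy

theorem eEquiv_of_diag1_eq (h : diag1 σ a = diag1 τ b) : EEquiv σ τ a b :=
  eEquiv_of_imp fun φ hφ hr => ((Set.ext_iff.1 h φ).1 ⟨hr, hφ⟩).1

/-- Over tuples with the same existential type, a solution of a quantifier-free `L₀`-formula
transfers to a smooth expansion together with its complete `L`-type. -/
theorem EEquiv.exists_sameType [Nonempty N] {T : L.Theory} (hNT : N ⊨ T) (hqe : HasQE L T)
    [Finite ι] (h : EEquiv σ τ a b) (hτ : τ.IsSmooth) {φ : (L.sum L').Formula (Fin k ⊕ ι)}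
    (hφ : φ.IsQF) {y : ι → N} (hy : σ.Sat φ (Sum.elim a y)) :
    ∃ z, τ.Sat φ (Sum.elim b z) ∧ SameType L (Sum.elim a y) (Sum.elim b z) := by
  have qe : ∀ χ : L.Formula (Fin k ⊕ ι), ∃ ψ : (L.sum L').Formula (Fin k ⊕ ι), ψ.IsQF ∧
      ∀ (ρ : Expansions L L' N) (v : Fin k ⊕ ι → N), ρ.Sat ψ v ↔ χ.Realize v := fun χ => by
    let e := Finite.equivFin (Fin k ⊕ ι)
    obtain ⟨ψ, hψ, hT⟩ := hqe _ (χ.relabel e)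
    refine ⟨(LHom.sumInl : L →ᴸ L.sum L').onFormula (ψ.relabel e.symm),
      isQF_onBoundedFormula _ (hψ.relabel _), fun ρ v => ?_⟩
    have := hT.realize_formula N (v := v ∘ e.symm)
    rw [Formula.realize_iff, Formula.realize_relabel] at this
    rw [sat_onFormula, Formula.realize_relabel, ← this, Function.comp_assoc]
    simp
  choose Q hQF hQ using qe
  let e := Finite.equivFin ι
  obtain ⟨z, hz, hp⟩ := hτ k _ b
    {χ | χ.Realize (Sum.elim a (y ∘ e.symm))} (φ.relabel (Sum.map id e)) (hφ.relabel _)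
    fun s hs => by
      obtain ⟨Φ, hΦ, hr⟩ := isQF_finset_inf s
        (f := fun χ => Q (χ.relabel (Sum.map id e.symm))) fun χ => hQF _
      have hrσ (ρ : Expansions L L' N) (v) : ρ.Sat Φ v ↔
          ∀ χ ∈ s, ρ.Sat (Q (χ.relabel (Sum.map id e.symm))) v := @hr N ρ.str0 v
      obtain ⟨z, hz⟩ := (h.exists_iff (hφ.inf hΦ)).1 ⟨y, sat_inf.2 ⟨hy, (hrσ σ _).2 fun χ hχ => by
        rw [hQ, Formula.realize_relabel, Sum.elim_comp_map]
        exact hs hχ⟩⟩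
      rw [sat_inf, hrσ] at hz
      refine ⟨z ∘ e.symm, sat_relabel.2 ?_, fun χ hχ => ?_⟩
      · rw [Sum.elim_comp_map, Function.comp_assoc]
        simpa using hz.1
      · have := hz.2 χ hχ
        rwa [hQ, Formula.realize_relabel, Sum.elim_comp_map] at this
  refine ⟨z ∘ e, ?_, ?_⟩
  · have := sat_relabel.1 hz
    rwa [Sum.elim_comp_map] at this
  · have := (sameType_of_imp hp).comp (Sum.map id e)
    simpa [Sum.elim_comp_map, Function.comp_assoc] using this

end Expansions

section Conjugation

variable {L L' : FirstOrder.Language.{0,0}} {N : Type} [L.Structure N]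

/-- The automorphism `g` as an isomorphism from `(N, σ)` to `(N, σ^g)`. -/
def conjEquiv (g : N ≃[L] N) (σ : Expansions L L' N) :
    @FirstOrder.Language.Equiv (L.sum L') N N σ.str0 (conjExp g σ).str0 :=
  @FirstOrder.Language.Equiv.mk (L.sum L') N N σ.str0 (conjExp g σ).str0 g.toEquiv
    (fun {n} F x => by
      cases F with
      | inl F => exact g.map_fun F x
      | inr F =>
        change g (σ.str.funMap F x) = g (σ.str.funMap F fun i => g.symm (g (x i)))
        simp)
    (fun {n} R x => by
      cases R with
      | inl R => exact g.map_rel R x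
      | inr R =>
        change σ.str.RelMap R (fun i => g.symm (g (x i))) ↔ σ.str.RelMap R x
        simp)

theorem sat_conjExp (g : N ≃[L] N) (σ : Expansions L L' N) {ι : Type}
    {φ : (L.sum L').Formula ι} {v : ι → N} :
    (conjExp g σ).Sat φ (g ∘ v) ↔ σ.Sat φ v :=
  @realize_comp_equiv (L.sum L') N N σ.str0 (conjExp g σ).str0 (conjEquiv g σ) ι φ v

theorem sat_conjExp_elim (g : N ≃[L] N) (σ : Expansions L L' N) {ι κ : Type}
    {φ : (L.sum L').Formula (ι ⊕ κ)} {v : ι → N} {x : κ → N} :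
    (conjExp g σ).Sat φ (Sum.elim v (g ∘ x)) ↔ σ.Sat φ (Sum.elim (g.symm ∘ v) x) := by
  rw [← sat_conjExp g σ, Sum.comp_elim, ← Function.comp_assoc]
  congr! 2
  ext i; simp

theorem eEquiv_conjExp (g : N ≃[L] N) (σ : Expansions L L' N) {k : ℕ} (b : Fin k → N) :
    EEquiv σ (conjExp g σ) b (g ∘ b) := fun m φ _ => by
  constructor
  · rintro ⟨y, hy⟩
    exact ⟨g ∘ y, by rwa [← Sum.comp_elim, sat_conjExp]⟩
  · rintro ⟨y, hy⟩
    refine ⟨g.symm ∘ y, ?_⟩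
    rw [← sat_conjExp g σ, Sum.comp_elim]
    convert hy using 2
    ext i; simp

theorem conjExp_mem_YSet (g : N ≃[L] N) {σ : Expansions L L' N} {T₀ : (L.sum L').Theory}
    (h : σ ∈ YSet L L' N T₀) : conjExp g σ ∈ YSet L L' N T₀ := by
  obtain ⟨hT, hs, hec⟩ := h
  refine ⟨?_, fun k n c p ψ hψ H => ?_, fun k n φ c hφ H => ?_⟩
  · exact @models_of_equiv (L.sum L') N N σ.str0 (conjExp g σ).str0 (conjEquiv g σ) T₀ hT
  · have hL (χ : L.Formula (Fin k ⊕ Fin n)) (x : Fin n → N) :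
        χ.Realize (Sum.elim c (g ∘ x)) ↔ χ.Realize (Sum.elim (g.symm ∘ c) x) := by
      rw [← realize_comp_equiv g χ (Sum.elim (g.symm ∘ c) x), Sum.comp_elim]
      congr! 2
      ext i; simp
    obtain ⟨x, hx, hp⟩ := hs k n (g.symm ∘ c) p ψ hψ fun s hsp => by
      obtain ⟨x, hx, hp⟩ := H s hsp
      obtain ⟨x, rfl⟩ : ∃ x', x = g ∘ x' := ⟨g.symm ∘ x, by ext i; simp⟩
      exact ⟨x, (sat_conjExp_elim g σ).1 hx, fun χ hχ => (hL χ x).1 (hp χ hχ)⟩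
    exact ⟨g ∘ x, (sat_conjExp_elim g σ).2 hx, fun χ hχ => (hL χ x).2 (hp χ hχ)⟩
  · obtain ⟨x, hx⟩ := hec k n φ (g.symm ∘ c) hφ <| by
      obtain ⟨U, iU, iU', j, hU, x, hx⟩ := H
      refine ⟨U, iU, iU', @Embedding.comp (L.sum L') N N σ.str0 (conjExp g σ).str0 U _ j
        (@FirstOrder.Language.Equiv.toEmbedding (L.sum L') N N σ.str0 (conjExp g σ).str0
          (conjEquiv g σ)), hU, x, ?_⟩
      convert hx using 2
      ext i
      exact congrArg (fun t => j t) (g.apply_symm_apply (c i))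
    exact ⟨g ∘ x, (sat_conjExp_elim g σ).2 hx⟩

end Conjugation

section Isolation

variable {L L' : FirstOrder.Language.{0,0}} {N : Type} [L.Structure N] [Nonempty N]
  {T : L.Theory} {T₀ : (L.sum L').Theory}

/-- An open set of 1-diagrams at `b` is a neighbourhood of each of its members through a single
existential quasifinite formula whose type part is complete. -/
theorem exists_sat_of_isOpen (hNT : N ⊨ T) (hqe : HasQE L T) {k : ℕ} {b : Fin k → N}
    {U : Set (DSet L L' N T₀ b)} (hU : @IsOpen _ (DTop L L' N T₀ b) U)
    {σ : Expansions L L' N} (hσ : σ ∈ YSet L L' N T₀) (hmem : ⟨diag1 σ b, σ, hσ, rfl⟩ ∈ U) :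
    ∃ (ι : Type) (_ : Finite ι) (φ : (L.sum L').Formula (Fin k ⊕ ι)) (y : ι → N),
      φ.IsQF ∧ σ.Sat φ (Sum.elim b y) ∧ ∀ (τ : Expansions L L' N) (hτ : τ ∈ YSet L L' N T₀)
        (z : ι → N), τ.Sat φ (Sum.elim b z) → SameType L (Sum.elim b y) (Sum.elim b z) →
          ⟨diag1 τ b, τ, hτ, rfl⟩ ∈ U := by
  induction hU with
  | basic s hs =>
    obtain ⟨π, hs⟩ := hs
    have hmem_iff (d : DSet L L' N T₀ b) : d ∈ s ↔ ↑d ∈ DBasic L L' N T₀ b π :=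
      Subtype.val_injective.mem_set_image.symm.trans (Set.ext_iff.1 hs d)
    obtain ⟨ρ, hρ, hd, y, hp, hy⟩ := (hmem_iff _).1 hmem
    obtain ⟨z, hz, hyz⟩ := (eEquiv_of_diag1_eq hd.symm).exists_sameType hNT hqe hσ.2.1 π.qf hy
    exact ⟨Fin π.m, inferInstance, π.φ, z, π.qf, hz, fun τ hτ w hw hzw =>
      (hmem_iff _).2 ⟨τ, hτ, rfl, w, fun χ hχ => (hzw χ).1 ((hyz χ).1 (hp χ hχ)), hw⟩⟩
  | univ =>
    exact ⟨Fin 0, inferInstance, ⊤, Fin.elim0, .top, fun h => h, fun _ _ _ _ _ => trivial⟩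
  | inter s t _ _ ihs iht =>
    obtain ⟨ι, _, φ, y, hφ, hy, h⟩ := ihs hmem.1
    obtain ⟨κ, _, ψ, z, hψ, hz, h'⟩ := iht hmem.2
    refine ⟨ι ⊕ κ, inferInstance,
      φ.relabel (Sum.map id Sum.inl) ⊓ ψ.relabel (Sum.map id Sum.inr), Sum.elim y z,
      (hφ.relabel _).inf (hψ.relabel _), ?_, fun τ hτ w hw hs => ⟨?_, ?_⟩⟩
    · simpa [sat_inf, sat_relabel, Sum.elim_comp_map] using ⟨hy, hz⟩
    · rw [sat_inf, sat_relabel, sat_relabel] at hw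
      refine h τ hτ (w ∘ Sum.inl) ?_ ?_
      · simpa [Sum.elim_comp_map] using hw.1
      · simpa [Sum.elim_comp_map] using hs.comp (Sum.map id Sum.inl)
    · rw [sat_inf, sat_relabel, sat_relabel] at hw
      refine h' τ hτ (w ∘ Sum.inr) ?_ ?_
      · simpa [Sum.elim_comp_map] using hw.2
      · simpa [Sum.elim_comp_map] using hs.comp (Sum.map id Sum.inr)
  | sUnion S _ ih =>
    obtain ⟨s, hs, hmem⟩ := hmem
    obtain ⟨ι, hι, φ, y, hφ, hy, h⟩ := ih s hs hmem
    exact ⟨ι, hι, φ, y, hφ, hy, fun τ hτ z hz hyz => ⟨s, hs, h τ hτ z hz hyz⟩⟩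

theorem EEquiv.exists_extend [Countable N] (hNT : N ⊨ T) (hqe : HasQE L T)
    (hsat : IsSaturated L N) {α β : Expansions L L' N} (hα : IsEAtomic L L' N T₀ α)
    (hβ : β ∈ YSet L L' N T₀) {k : ℕ} {a b : Fin k → N} (h : EEquiv α β a b) (c : N) :
    ∃ d, EEquiv α β (extend a c) (extend b d) := by
  obtain ⟨ι, _, φ, y, hφ, hy, hiso⟩ :=
    exists_sat_of_isOpen hNT hqe (hα.2 _ (extend a c)) hα.1 (by exact rfl)
  let s : Fin (k + 1) ⊕ ι → Fin k ⊕ (Fin 1 ⊕ ι) :=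
    Equiv.sumAssoc _ _ _ ∘ Sum.map finSumFinEquiv.symm id
  have hs (u : Fin k → N) (v : Fin 1 → N) (w : ι → N) :
      Sum.elim u (Sum.elim v w) ∘ s = Sum.elim (extend u (v 0)) w := by
    ext i
    rcases i with i | i
    · obtain ⟨i, rfl⟩ := finSumFinEquiv.surjective i
      rcases i with i | i
      · simp [s, extend]
      · simp [s, extend, Subsingleton.elim i 0]
    · simp [s]
  obtain ⟨z, hz, hyz⟩ := h.exists_sameType hNT hqe hβ.2.1 (φ := φ.relabel s) (hφ.relabel _)
    (y := Sum.elim (fun _ => c) y) (by rwa [sat_relabel, hs])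
  obtain ⟨d, w, rfl⟩ : ∃ d w, z = Sum.elim d w := ⟨_, _, (Sum.elim_comp_inl_inr z).symm⟩
  rw [sat_relabel, hs] at hz
  have hyz := hyz.comp s
  rw [hs, hs] at hyz
  obtain ⟨g, hg⟩ := (hyz.comp Sum.inl).symm.exists_automorphism hsat
  simp only [Sum.elim_comp_inl] at hg
  have hconj : diag1 (conjExp g β) (extend a c) = diag1 α (extend a c) := by
    have hgs := sameType_equiv g (Sum.elim (extend b (d 0)) w)
    rw [Sum.comp_elim, hg] at hgs
    refine hiso _ (conjExp_mem_YSet g hβ) (g ∘ w) ?_ (hyz.trans hgs)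
    rwa [← hg, ← Sum.comp_elim, sat_conjExp]
  have hgb := eEquiv_conjExp g β (extend b (d 0))
  rw [hg] at hgb
  exact ⟨d 0, (hgb.trans (eEquiv_of_diag1_eq hconj)).symm⟩

end Isolation

/-- Suppose all e.c. models of `T₀` have the same existential theory
and `α`, `β` are e-atomic. Then every finite 1-elementary partial map
`f : (N, α) → (N, β)` (one preserving existential and universal formulas) extends to an
isomorphism `(N, α) → (N, β)`. -/
theorem statement9
    (T : L.Theory) (T₀ : (L.sum L').Theory)
    [Countable N] (hNT : N ⊨ T) (hTc : T.IsComplete) (hqe : HasQE L T)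
    (hsmall : IsSmall L T) (hsat : IsSaturated L N)
    [Finite (Σ i, L'.Functions i)] [Finite (Σ i, L'.Relations i)]
    (hTT₀ : (LHom.sumInl : L →ᴸ L.sum L').onTheory T ⊆ T₀)
    (huniv : UniversalTheoryModulo L L' T T₀)
    (hsame : SameExistentialTheory L L' T₀)
    (α β : Expansions L L' N)
    (hα : IsEAtomic L L' N T₀ α) (hβ : IsEAtomic L L' N T₀ β)
    (k : ℕ) (a b : Fin k → N)
    -- the finite partial map `a i ↦ b i` is 1-elementary:
    (h1elem : ∀ φ : (L.sum L').Formula (Fin k),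
      BoundedFormula.IsUniversal φ ∨ BoundedFormula.IsExistential φ →
      α.Realizes φ a → β.Realizes φ b) :
    ∃ g : @FirstOrder.Language.Equiv (L.sum L') N N α.str0 β.str0,
      ∀ i : Fin k,
        (@FirstOrder.Language.Equiv.toEquiv (L.sum L') N N α.str0 β.str0 g) (a i) = b i := by
  have hab : EEquiv α β a b := eEquiv_of_imp h1elem
  obtain ⟨e, he, hP⟩ : ∃ e : N ≃ N, e ∘ a = b ∧
      ∀ (n : ℕ) (c : Fin n → N), EEquiv α β c (e ∘ c) := by
    rcases isEmpty_or_nonempty N with hN | hN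
    · refine ⟨_root_.Equiv.refl N, Subsingleton.elim _ _, fun n c => ?_⟩
      have := hab.comp fun i => isEmptyElim (c i)
      rwa [Subsingleton.elim (a ∘ _) c, Subsingleton.elim (b ∘ _) c] at this
    · exact exists_equiv_of_backAndForth (P := fun k (a b : Fin k → N) => EEquiv α β a b)
        (fun s _ _ h => h.comp s) (fun h => h.eq_iff)
        (fun h => h.exists_extend hNT hqe hsat hα hβ.1)
        (fun h d => (h.symm.exists_extend hNT hqe hsat hβ hα.1 d).imp fun _ => EEquiv.symm) hab
  exact ⟨@equivOfRealize (L.sum L') N N α.str0 β.str0 e fun n φ hφ c => (hP n c).sat_iff hφ,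
    fun i => congr_fun he i⟩

end GenExp
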